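/- Let p ∈ ℝ_{≥0}, let f ∈ C^∞(ℝ) be such that f' is of order at most −p−1, let n ≥ 2, and define g_n : ℝ → ℝ by g_n(x) := −x^{n−2} f'(1/x) for x ≠ 0 and g_n(0) := 0. Then there exist δ, c_2 > 0 such that |g_n^{(n−1)}(x)| ≤ c_2 |x|^p for all x with 0 < |x| < δ. -/

import Mathlib

/-- `f` is of order at most `r`: for every `k` there are `R, c₂ > 0` with
`|f^(k)(x)| ≤ c₂ |x|^(r-k)` for all `|x| > R`. -/
def OrderAtMost (f : ℝ → ℝ) (r : ℝ) : Prop :=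
  ∀ k : ℕ, ∃ R c₂ : ℝ, 0 < R ∧ 0 < c₂ ∧
    ∀ x : ℝ, R < |x| → |iteratedDeriv k f x| ≤ c₂ * |x| ^ (r - (k : ℝ))

/-- The function `g_n(x) = −x^(n−2) f'(1/x)` for `x ≠ 0`, with `g_n(0) = 0`. -/
noncomputable def gfun (f : ℝ → ℝ) (n : ℕ) (x : ℝ) : ℝ :=
  if x = 0 then 0 else -x ^ (n - 2) * deriv f (1 / x)

/-- The derivative of `y ↦ y ^ j * h^(k)(1/y)` away from `0`. -/
theorem hasDerivAt_zpow_mul_iteratedDeriv_inv {h : ℝ → ℝ} (hh : ContDiff ℝ (⊤ : ℕ∞) h)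
    (j : ℤ) (k : ℕ) {x : ℝ} (hx : x ≠ 0) :
    HasDerivAt (fun y : ℝ => y ^ j * iteratedDeriv k h y⁻¹)
      (j * (x ^ (j - 1) * iteratedDeriv k h x⁻¹)
        - x ^ (j - 2) * iteratedDeriv (k + 1) h x⁻¹) x := by
  have hd : HasDerivAt (iteratedDeriv k h) (iteratedDeriv (k + 1) h x⁻¹) x⁻¹ := by
    rw [iteratedDeriv_succ]
    exact (hh.differentiable_iteratedDeriv k (mod_cast WithTop.coe_lt_top k) x⁻¹).hasDerivAt
  refine ((hasDerivAt_zpow j x (Or.inl hx)).mul (hd.comp x (hasDerivAt_inv hx))).congr_deriv ?_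
  have hpow : x ^ j = x ^ (j - 2) * x ^ 2 := by
    rw [← zpow_natCast, ← zpow_add₀ hx]
    simp
  rw [hpow, Function.comp_apply]
  field_simp
  ring

theorem contDiffAt_zpow_mul_iteratedDeriv_inv {h : ℝ → ℝ} (hh : ContDiff ℝ (⊤ : ℕ∞) h)
    (j : ℤ) (k m : ℕ) {x : ℝ} (hx : x ≠ 0) :
    ContDiffAt ℝ m (fun y : ℝ => y ^ j * iteratedDeriv k h y⁻¹) x := by
  have hk : ContDiff ℝ m (iteratedDeriv k h) := by
    rw [iteratedDeriv_eq_iterate]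
    exact ContDiff.iterate_deriv' m k (hh.of_le (mod_cast le_top))
  have hz : ContDiffAt ℝ m (fun y : ℝ => y ^ j) x := by
    cases j with
    | ofNat a => simpa using contDiffAt_id.pow a
    | negSucc a =>
      simp only [zpow_negSucc]
      exact (contDiffAt_id.pow (a + 1)).inv (pow_ne_zero _ hx)
  exact hz.mul (hk.contDiffAt.comp x (contDiffAt_inv ℝ hx))

/-- If `h` is of order at most `r`, each derivative of `y ↦ y ^ j * h^(k)(1/y)` has the expected
growth at `0`. -/
theorem OrderAtMost.exists_abs_iteratedDeriv_zpow_mul_le {h : ℝ → ℝ} {r : ℝ}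
    (ho : OrderAtMost h r) (hh : ContDiff ℝ (⊤ : ℕ∞) h) (m : ℕ) (j : ℤ) (k : ℕ) :
    ∃ δ c : ℝ, 0 < δ ∧ 0 < c ∧ ∀ x : ℝ, 0 < |x| → |x| < δ →
      |iteratedDeriv m (fun y : ℝ => y ^ j * iteratedDeriv k h y⁻¹) x|
        ≤ c * |x| ^ ((j : ℝ) - r + k - m) := by
  induction m generalizing j k with
  | zero =>
    obtain ⟨R, c, hR, hc, hb⟩ := ho k
    refine ⟨R⁻¹, c, inv_pos.2 hR, hc, fun x hx hxR => ?_⟩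
    have hx' : R < |x⁻¹| := by
      rw [abs_inv]
      exact (lt_inv_comm₀ hx hR).1 hxR
    calc |iteratedDeriv 0 (fun y : ℝ => y ^ j * iteratedDeriv k h y⁻¹) x|
        = |x| ^ j * |iteratedDeriv k h x⁻¹| := by
          rw [iteratedDeriv_zero, abs_mul, abs_zpow]
      _ ≤ |x| ^ j * (c * |x⁻¹| ^ (r - k)) := by
          gcongr
          exact hb _ hx'
      _ = c * |x| ^ ((j : ℝ) - r + k - (0 : ℕ)) := by
          rw [abs_inv, Real.inv_rpow hx.le, ← Real.rpow_neg hx.le, ← Real.rpow_intCast,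
            mul_left_comm, ← Real.rpow_add hx]
          congr 2
          push_cast
          ring
  | succ m ih =>
    obtain ⟨δ₁, c₁, hδ₁, hc₁, h₁⟩ := ih (j - 1) k
    obtain ⟨δ₂, c₂, hδ₂, hc₂, h₂⟩ := ih (j - 2) (k + 1)
    refine ⟨min δ₁ δ₂, |(j : ℝ)| * c₁ + c₂, lt_min hδ₁ hδ₂, by positivity, fun x hx hxδ => ?_⟩
    have hx0 : x ≠ 0 := abs_pos.1 hx
    have hev : deriv (fun y : ℝ => y ^ j * iteratedDeriv k h y⁻¹) =ᶠ[nhds x] fun y =>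
        j * (y ^ (j - 1) * iteratedDeriv k h y⁻¹)
          - y ^ (j - 2) * iteratedDeriv (k + 1) h y⁻¹ := by
      filter_upwards [isOpen_ne.mem_nhds hx0] with y hy
      exact (hasDerivAt_zpow_mul_iteratedDeriv_inv hh j k hy).deriv
    have hA := contDiffAt_zpow_mul_iteratedDeriv_inv hh (j - 1) k m hx0
    have hB := contDiffAt_zpow_mul_iteratedDeriv_inv hh (j - 2) (k + 1) m hx0
    rw [iteratedDeriv_succ', hev.iteratedDeriv_eq, iteratedDeriv_fun_sub
      (contDiffAt_const.mul hA) hB, iteratedDeriv_const_mul_field]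
    have e₁ := h₁ x hx (hxδ.trans_le (min_le_left _ _))
    have e₂ := h₂ x hx (hxδ.trans_le (min_le_right _ _))
    have q₁ : ((j - 1 : ℤ) : ℝ) - r + k - m = (j : ℝ) - r + k - (m + 1 : ℕ) := by
      push_cast
      ring
    have q₂ : ((j - 2 : ℤ) : ℝ) - r + (k + 1 : ℕ) - m = (j : ℝ) - r + k - (m + 1 : ℕ) := by
      push_cast
      ring
    rw [q₁] at e₁
    rw [q₂] at e₂
    refine (abs_sub _ _).trans ?_
    rw [abs_mul, add_mul, mul_assoc]
    gcongr

/-- if `f'` is of order at most `−p−1` (`p ≥ 0`) and `n ≥ 2`, then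
near `0` (away from `0` itself) one has `|g_n^(n−1)(x)| ≤ c₂ |x|^p`. -/
theorem statement2 (p : ℝ) (hp : 0 ≤ p) (f : ℝ → ℝ) (hf : ContDiff ℝ (⊤ : ℕ∞) f)
    (hord : OrderAtMost (deriv f) (-p - 1)) (n : ℕ) (hn : 2 ≤ n) :
    ∃ δ c₂ : ℝ, 0 < δ ∧ 0 < c₂ ∧
      ∀ x : ℝ, 0 < |x| → |x| < δ →
        |iteratedDeriv (n - 1) (gfun f n) x| ≤ c₂ * |x| ^ p := by
  have hdf : ContDiff ℝ (⊤ : ℕ∞) (deriv f) := (contDiff_infty_iff_deriv.1 hf).2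
  obtain ⟨δ, c, hδ, hc, hb⟩ :=
    hord.exists_abs_iteratedDeriv_zpow_mul_le hdf (n - 1) (n - 2 : ℕ) 0
  refine ⟨δ, c, hδ, hc, fun x hx hxδ => ?_⟩
  have hev : gfun f n =ᶠ[nhds x] fun y =>
      -(y ^ ((n - 2 : ℕ) : ℤ) * iteratedDeriv 0 (deriv f) y⁻¹) := by
    filter_upwards [isOpen_ne.mem_nhds (abs_pos.1 hx)] with y hy
    have hy0 : y ≠ 0 := hy
    simp [gfun, hy0]
  rw [hev.iteratedDeriv_eq, iteratedDeriv_fun_neg, abs_neg]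
  convert hb x hx hxδ using 3
  rw [Int.cast_natCast, Nat.cast_sub hn, Nat.cast_sub (by omega : 1 ≤ n)]
  push_cast
  ring
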